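/- arXiv:physics/0611111 — 7 statements merged into one kernel-verified Lean document; each statement's English description precedes it below -/
import Mathlib

section
/- Suppose σ > 1 > τ > 0, 0 < η < η_c, α² = π²/2 and λ = λ_c. Then the cubic polynomial f_{11}(β) has three pairwise distinct real roots, and β = 0 is one of them. -/
open Real

/-- γ_{jl}² = j²α² + l²π². -/
noncomputable def gamma2 (α : ℝ) (j : ℤ) (l : ℕ) : ℝ :=
  (j : ℝ)^2 * α^2 + (l : ℝ)^2 * π^2

/-- The cubic polynomial f_{jl}(β). -/
noncomputable def fjl (σ τ lam η α : ℝ) (j : ℤ) (l : ℕ) (β : ℝ) : ℝ :=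
  β^3 + (σ + τ + 1) * gamma2 α j l * β^2
    + ((σ + τ + σ*τ) * (gamma2 α j l)^2
        - σ * (j : ℝ)^2 * α^2 * (gamma2 α j l)⁻¹ * (lam - η)) * β
    + σ * τ * (gamma2 α j l)^3 + σ * (j : ℝ)^2 * α^2 * (η - τ * lam)

/-- A monic cubic without constant term, whose quadratic cofactor has nonzero constant term and
positive discriminant, splits with three distinct roots, one of them zero. -/
theorem exists_distinct_roots_of_cubic {b c : ℝ} (hc : c ≠ 0) (hd : 0 < b ^ 2 - 4 * c) :
    ∃ b₁ b₂ b₃ : ℝ, b₁ ≠ b₂ ∧ b₁ ≠ b₃ ∧ b₂ ≠ b₃ ∧ (b₁ = 0 ∨ b₂ = 0 ∨ b₃ = 0) ∧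
      ∀ x : ℝ, x ^ 3 + b * x ^ 2 + c * x = (x - b₁) * (x - b₂) * (x - b₃) := by
  have hs := Real.sq_sqrt hd.le
  have hpos := Real.sqrt_pos.2 hd
  set s := √(b ^ 2 - 4 * c)
  have hprod : (-b + s) / 2 * ((-b - s) / 2) = c := by linear_combination -hs / 4
  refine ⟨0, (-b + s) / 2, (-b - s) / 2, fun h ↦ hc ?_, fun h ↦ hc ?_, by linarith, .inl rfl,
    fun x ↦ ?_⟩
  · rw [← hprod, ← h, zero_mul]
  · rw [← hprod, ← h, mul_zero]
  · linear_combination -x * hprod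

/-- for σ > 1 > τ > 0, 0 < η < η_c, α² = π²/2 and λ = λ_c,
the cubic f₁₁ has three pairwise distinct real roots, one of which is β = 0. -/
theorem stmt0 (σ τ η α lam : ℝ)
    (hσ : 1 < σ) (hτ1 : τ < 1) (hτ0 : 0 < τ)
    (hη0 : 0 < η)
    (hηc : η < (27/4) * π^4 * τ^2 * (1 + σ⁻¹) * (1 - τ)⁻¹)
    (hα : α^2 = π^2 / 2)
    (hlam : lam = η / τ + (27/4) * π^4) :
    ∃ b₁ b₂ b₃ : ℝ, b₁ ≠ b₂ ∧ b₁ ≠ b₃ ∧ b₂ ≠ b₃ ∧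
      (b₁ = 0 ∨ b₂ = 0 ∨ b₃ = 0) ∧
      ∀ β : ℝ, fjl σ τ lam η α 1 1 β = (β - b₁) * (β - b₂) * (β - b₃) := by
  have hσ0 : 0 < σ := by linarith
  have hτ' : 0 < 1 - τ := by linarith
  have hπ := Real.pi_pos
  have hg : gamma2 α 1 1 = 3 / 2 * π ^ 2 := by
    simp only [gamma2, Int.cast_one, Nat.cast_one, hα]
    ring
  set c : ℝ := 9 / 4 * π ^ 4 * (τ * (1 + σ)) - σ / 3 * (η * (1 - τ) / τ) with hcdef
  have hf (β : ℝ) : fjl σ τ lam η α 1 1 β =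
      β ^ 3 + (σ + τ + 1) * (3 / 2 * π ^ 2) * β ^ 2 + c * β := by
    simp only [fjl, hg, Int.cast_one, hα, hlam, hcdef]
    field_simp
    ring
  have hc : 0 < c := by
    have hc_eq : c = σ * (1 - τ) / (3 * τ) *
        ((27/4) * π^4 * τ^2 * (1 + σ⁻¹) * (1 - τ)⁻¹ - η) := by
      rw [hcdef]
      field_simp
      ring
    rw [hc_eq]
    have := sub_pos.2 hηc
    positivity
  have hd : 0 < ((σ + τ + 1) * (3 / 2 * π ^ 2)) ^ 2 - 4 * c := by
    have hd_eq : ((σ + τ + 1) * (3 / 2 * π ^ 2)) ^ 2 - 4 * c =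
        9 / 4 * π ^ 4 * (σ + (1 - τ)) ^ 2 + 4 * (σ / 3 * (η * (1 - τ) / τ)) := by
      rw [hcdef]
      ring
    rw [hd_eq]
    positivity
  simpa only [hf] using exists_distinct_roots_of_cubic hc.ne' hd
end

section
/- Suppose σ > 0, τ > 1, η > 0, α² = π²/2 and λ = λ_c. Then β = 0 is a simple root of the cubic polynomial f_{11}(β), i.e. f_{11}(0) = 0 and f_{11}'(0) ≠ 0. -/
open Real

theorem gamma2_one_one {α : ℝ} (hα : α^2 = π^2 / 2) : gamma2 α 1 1 = 3 / 2 * π^2 := by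
  simp only [gamma2, hα]
  push_cast
  ring

theorem hasDerivAt_fjl_zero (σ τ lam η α : ℝ) (j : ℤ) (l : ℕ) :
    HasDerivAt (fjl σ τ lam η α j l)
      ((σ + τ + σ*τ) * (gamma2 α j l)^2
        - σ * (j : ℝ)^2 * α^2 * (gamma2 α j l)⁻¹ * (lam - η)) 0 := by
  have h := (((((hasDerivAt_id (0 : ℝ)).pow 3).add
    (((hasDerivAt_id (0 : ℝ)).pow 2).const_mul ((σ + τ + 1) * gamma2 α j l))).add
    ((hasDerivAt_id (0 : ℝ)).const_mul ((σ + τ + σ*τ) * (gamma2 α j l)^2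
        - σ * (j : ℝ)^2 * α^2 * (gamma2 α j l)⁻¹ * (lam - η)))).add_const
    (σ * τ * (gamma2 α j l)^3)).add_const (σ * (j : ℝ)^2 * α^2 * (η - τ * lam))
  exact h.congr_deriv (by simp)

/-- for σ > 0, τ > 1, η > 0, α² = π²/2 and λ = λ_c,
β = 0 is a simple root of f₁₁: f₁₁(0) = 0 and f₁₁'(0) ≠ 0. -/
theorem stmt1 (σ τ η α lam : ℝ)
    (hσ : 0 < σ) (hτ : 1 < τ) (hη : 0 < η)
    (hα : α^2 = π^2 / 2)
    (hlam : lam = η / τ + (27/4) * π^4) :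
    fjl σ τ lam η α 1 1 0 = 0 ∧ deriv (fjl σ τ lam η α 1 1) 0 ≠ 0 := by
  have hτ0 : 0 < τ := one_pos.trans hτ
  constructor
  · simp only [fjl, gamma2_one_one hα, hα, hlam]
    push_cast
    field_simp
    ring
  · rw [(hasDerivAt_fjl_zero σ τ lam η α 1 1).deriv, gamma2_one_one hα, hα, hlam]
    have hη' : 0 < η - η / τ := sub_pos.2 (div_lt_self hη hτ)
    have key : (σ + τ + σ*τ) * (3 / 2 * π^2)^2
        - σ * ((1 : ℤ) : ℝ)^2 * (π^2 / 2) * (3 / 2 * π^2)⁻¹ * (η / τ + (27/4) * π^4 - η)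
        = 9 / 4 * τ * (1 + σ) * π^4 + σ / 3 * (η - η / τ) := by
      push_cast
      field_simp
      ring
    rw [key]
    positivity
end

section
/- Assume σ > 1 > τ > 0, α² = π²/2 and 0 < η < η_c. Then: (i) if λ < λ_c, every complex root of f_{jl} has negative real part, for every j ∈ ℤ and every l ≥ 1; (ii) if λ = λ_c, then 0 is a simple root of f_{11}, every other root of f_{11} has negative real part, and every root of f_{jl} for (j², l) ≠ (1, 1) has negative real part; (iii) if λ > λ_c, then f_{11} has a positive real root. -/
open Real

/-- The cubic polynomial f_{jl}(β) evaluated at complex arguments via its real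
coefficients. -/
noncomputable def fjlC (σ τ lam η α : ℝ) (j : ℤ) (l : ℕ) (β : ℂ) : ℂ :=
  β^3 + (((σ + τ + 1) * gamma2 α j l : ℝ) : ℂ) * β^2
    + ((((σ + τ + σ*τ) * (gamma2 α j l)^2
        - σ * (j : ℝ)^2 * α^2 * (gamma2 α j l)⁻¹ * (lam - η)) : ℝ) : ℂ) * β
    + (((σ * τ * (gamma2 α j l)^3 + σ * (j : ℝ)^2 * α^2 * (η - τ * lam)) : ℝ) : ℂ)

/-- Routh–Hurwitz criterion for real cubics, allowing a root at the origin. -/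
theorem re_neg_of_cubic_root {a b c : ℝ} (ha : 0 < a) (hb : 0 < b) (hc : 0 ≤ c)
    (hab : c < a * b) {β : ℂ} (hβ : β ≠ 0)
    (h : β ^ 3 + (a : ℂ) * β ^ 2 + (b : ℂ) * β + (c : ℂ) = 0) : β.re < 0 := by
  obtain ⟨x, y⟩ := β
  have hre := congrArg Complex.re h
  have him := congrArg Complex.im h
  simp [pow_succ] at hre him
  change x < 0
  by_contra! hx
  rcases eq_or_ne y 0 with rfl | hy
  · have hx0 : x ≠ 0 := by
      rintro rfl
      exact hβ rfl
    have hxpos : 0 < x := lt_of_le_of_ne hx hx0.symm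
    have : 0 < x ^ 3 + a * x ^ 2 + b * x + c := by positivity
    nlinarith
  · have hy2 : y ^ 2 = 3 * x ^ 2 + 2 * a * x + b := by
      apply mul_left_cancel₀ hy
      linear_combination -him
    have : 8 * x ^ 3 + 8 * a * x ^ 2 + 2 * (a ^ 2 + b) * x + (a * b - c) = 0 := by
      linear_combination -hre - (3 * x + a) * hy2
    have : 0 ≤ 8 * x ^ 3 + 8 * a * x ^ 2 + 2 * (a ^ 2 + b) * x := by positivity
    linarith

theorem cubic_ge_linear {k m P : ℝ} (hk : 0 ≤ k) (hP : 0 < P) (hm : P ≤ m) :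
    27 / 4 * P ^ 2 * k ≤ (k + m) ^ 3 := by
  have h1 : 0 ≤ (k + 4 * m) * (2 * k - m) ^ 2 :=
    mul_nonneg (by linarith) (sq_nonneg _)
  have h2 : P ^ 2 * k ≤ m ^ 2 * k := by gcongr
  linarith

theorem cubic_eq_linear_iff {k m P : ℝ} (hk : 0 ≤ k) (hP : 0 < P) (hm : P ≤ m) :
    27 / 4 * P ^ 2 * k = (k + m) ^ 3 ↔ m = P ∧ 2 * k = P := by
  refine ⟨fun h => ?_, fun ⟨h1, h2⟩ => by subst h1; rw [← h2]; ring⟩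
  have h1 : 0 ≤ (k + 4 * m) * (2 * k - m) ^ 2 :=
    mul_nonneg (by linarith) (sq_nonneg _)
  have h2 : P ^ 2 * k ≤ m ^ 2 * k := by gcongr
  have h3 : (k + 4 * m) * (2 * k - m) ^ 2 = 0 := by linarith
  have h4 : 2 * k = m := by
    have : (2 * k - m) ^ 2 = 0 := (mul_eq_zero.mp h3).resolve_left (by linarith)
    linarith [pow_eq_zero_iff two_ne_zero |>.mp this]
  have hk0 : 0 < k := by linarith
  have h5 : m ^ 2 = P ^ 2 := mul_right_cancel₀ hk0.ne' (by linarith)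
  have h6 : m = P := (sq_eq_sq₀ (by linarith) hP.le).mp h5
  exact ⟨h6, h4.trans h6⟩

/-- The Hurwitz determinant of `fjl`, up to the critical parameter, is positive. -/
theorem hurwitz_det_pos {σ τ η lam k g R : ℝ} (hσ : 0 < σ) (hτ : 0 < τ) (hg : 0 < g)
    (hk : 0 ≤ k) (hkg : R * k ≤ g ^ 3) (hη : η * (σ * (1 - τ)) < R * τ ^ 2 * (σ + 1))
    (hlam : τ * lam ≤ η + τ * R) :
    σ * τ * g ^ 3 + σ * k * (η - τ * lam) <
      (σ + τ + 1) * g * ((σ + τ + σ * τ) * g ^ 2 - σ * k * g⁻¹ * (lam - η)) := by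
  have hinv : g * g⁻¹ = 1 := mul_inv_cancel₀ hg.ne'
  have key : (σ + τ + 1) * g * ((σ + τ + σ * τ) * g ^ 2 - σ * k * g⁻¹ * (lam - η))
      - (σ * τ * g ^ 3 + σ * k * (η - τ * lam))
      = (σ + τ) * (1 + σ) * (1 + τ) * g ^ 3 - σ * k * ((σ + 1) * lam - (σ + τ) * η) := by
    linear_combination (-(σ + τ + 1) * σ * k * (lam - η)) * hinv
  rw [← sub_pos, key]
  rcases hk.eq_or_lt with rfl | hk
  · simp only [mul_zero, zero_mul, sub_zero]
    positivity
  refine pos_of_mul_pos_right (b := _) (a := τ) ?_ hτ.le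
  have e1 : τ * ((σ + τ) * (1 + σ) * (1 + τ)) * (R * k) ≤
      τ * ((σ + τ) * (1 + σ) * (1 + τ)) * g ^ 3 := by gcongr
  have e2 : σ * k * (σ + 1) * (τ * lam) ≤ σ * k * (σ + 1) * (η + τ * R) := by gcongr
  have e3 : k * (σ + 1 + τ) * (η * (σ * (1 - τ))) <
      k * (σ + 1 + τ) * (R * τ ^ 2 * (σ + 1)) := by gcongr
  linarith

theorem gamma2_pos (α : ℝ) (j : ℤ) {l : ℕ} (hl : 1 ≤ l) : 0 < gamma2 α j l := by
  have : (0 : ℝ) < l := by exact_mod_cast hl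
  unfold gamma2
  positivity

theorem gamma2_cubed_ge (α : ℝ) (j : ℤ) {l : ℕ} (hl : 1 ≤ l) :
    27 / 4 * π ^ 4 * ((j : ℝ) ^ 2 * α ^ 2) ≤ gamma2 α j l ^ 3 := by
  have hl' : (1 : ℝ) ≤ l := by exact_mod_cast hl
  have := cubic_ge_linear (k := (j : ℝ) ^ 2 * α ^ 2) (m := (l : ℝ) ^ 2 * π ^ 2) (P := π ^ 2)
    (by positivity) (by positivity) (le_mul_of_one_le_left (by positivity) (one_le_pow₀ hl'))
  rwa [← pow_mul] at this

theorem gamma2_cubed_eq_iff {α : ℝ} (hα : α ^ 2 = π ^ 2 / 2) (j : ℤ) {l : ℕ} (hl : 1 ≤ l) :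
    27 / 4 * π ^ 4 * ((j : ℝ) ^ 2 * α ^ 2) = gamma2 α j l ^ 3 ↔ (j ^ 2, l) = ((1 : ℤ), 1) := by
  have hl' : (1 : ℝ) ≤ l := by exact_mod_cast hl
  have hπ : (0 : ℝ) < π ^ 2 := by positivity
  have := cubic_eq_linear_iff (k := (j : ℝ) ^ 2 * α ^ 2) (m := (l : ℝ) ^ 2 * π ^ 2) (P := π ^ 2)
    (by positivity) hπ (le_mul_of_one_le_left (by positivity) (one_le_pow₀ hl'))
  rw [← pow_mul] at this
  refine this.trans ?_
  rw [Prod.mk.injEq, and_comm]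
  refine and_congr ?_ ?_
  · rw [hα, show 2 * ((j : ℝ) ^ 2 * (π ^ 2 / 2)) = (j : ℝ) ^ 2 * π ^ 2 by ring,
      mul_eq_right₀ hπ.ne']
    exact_mod_cast Iff.rfl
  · rw [mul_eq_right₀ hπ.ne', pow_eq_one_iff_of_nonneg (by positivity) two_ne_zero,
      Nat.cast_eq_one]

/-- Up to the critical parameter, nonzero roots of `fjlC` lie in the open left half-plane. -/
theorem fjlC_root_re_neg {σ τ lam η α : ℝ} (hσ : 0 < σ) (hτ : 0 < τ)
    (hη : η * (σ * (1 - τ)) < 27 / 4 * π ^ 4 * τ ^ 2 * (σ + 1))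
    (hlam : τ * lam ≤ η + τ * (27 / 4 * π ^ 4)) (j : ℤ) {l : ℕ} (hl : 1 ≤ l) {β : ℂ}
    (h : fjlC σ τ lam η α j l β = 0) (hβ : β ≠ 0) : β.re < 0 := by
  have hg := gamma2_pos α j hl
  have hkg := gamma2_cubed_ge α j hl
  have hk : 0 ≤ (j : ℝ) ^ 2 * α ^ 2 := by positivity
  have hdet := hurwitz_det_pos hσ hτ hg hk hkg hη hlam
  have ha : 0 < (σ + τ + 1) * gamma2 α j l := by positivity
  have hc : 0 ≤ σ * τ * gamma2 α j l ^ 3 + σ * ((j : ℝ) ^ 2 * α ^ 2) * (η - τ * lam) := by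
    have e1 := mul_le_mul_of_nonneg_left hlam (mul_nonneg hσ.le hk)
    have e2 := mul_le_mul_of_nonneg_left hkg (mul_pos hσ hτ).le
    linarith
  simp only [← mul_assoc] at hdet hc
  refine re_neg_of_cubic_root ha ?_ hc ?_ hβ h
  · exact pos_of_mul_pos_right (hc.trans_lt (by simpa only [mul_assoc] using hdet)) ha.le
  · simpa only [mul_assoc] using hdet

theorem ne_zero_of_fjlC_eq_zero {σ τ lam η α : ℝ} (hσ : 0 < σ) (j : ℤ) (l : ℕ)
    (h0 : (τ * lam - η) * ((j : ℝ) ^ 2 * α ^ 2) < τ * gamma2 α j l ^ 3) {β : ℂ}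
    (h : fjlC σ τ lam η α j l β = 0) : β ≠ 0 := by
  rintro rfl
  simp only [fjlC, ne_eq, OfNat.ofNat_ne_zero, not_false_eq_true, zero_pow, mul_zero, add_zero,
    zero_add, Complex.ofReal_eq_zero] at h
  have := mul_lt_mul_of_pos_left h0 hσ
  linarith

theorem exists_nonneg_cubic_nonneg {a : ℝ} (ha : 0 ≤ a) (b c : ℝ) :
    ∃ M : ℝ, 0 ≤ M ∧ 0 ≤ M ^ 3 + a * M ^ 2 + b * M + c := by
  refine ⟨1 + |b| + |c|, by positivity, ?_⟩
  have hM : 1 ≤ 1 + |b| + |c| := by linarith [abs_nonneg b, abs_nonneg c]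
  set M := 1 + |b| + |c| with hMdef
  have hc : |c| ≤ M * |c| := le_mul_of_one_le_left (abs_nonneg c) hM
  have hb : -|b| * M ≤ b * M := by
    gcongr
    exact neg_abs_le b
  have hcube : M * M ≤ M ^ 3 := by nlinarith
  have hsq : M * M = M + |b| * M + M * |c| := by
    nth_rewrite 1 [hMdef]
    ring
  have ha2 : 0 ≤ a * M ^ 2 := by positivity
  linarith [neg_abs_le c]

theorem hasDerivAt_cubic_zero (a b c : ℂ) :
    HasDerivAt (fun β : ℂ => β ^ 3 + a * β ^ 2 + b * β + c) b 0 := by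
  have := (((hasDerivAt_pow 3 (0 : ℂ)).add ((hasDerivAt_pow 2 (0 : ℂ)).const_mul a)).add
    ((hasDerivAt_id (0 : ℂ)).const_mul b)).add_const c
  simpa using this

/-- Principle of Exchange of Stabilities for σ > 1 > τ > 0,
α² = π²/2, 0 < η < η_c. -/
theorem stmt4 (σ τ η α lam : ℝ)
    (hσ : 1 < σ) (hτ1 : τ < 1) (hτ0 : 0 < τ)
    (hη0 : 0 < η)
    (hηc : η < (27/4) * π^4 * τ^2 * (1 + σ⁻¹) * (1 - τ)⁻¹)
    (hα : α^2 = π^2 / 2) :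
    (lam < η / τ + (27/4) * π^4 →
      ∀ j : ℤ, ∀ l : ℕ, 1 ≤ l →
        ∀ β : ℂ, fjlC σ τ lam η α j l β = 0 → β.re < 0) ∧
    (lam = η / τ + (27/4) * π^4 →
      fjlC σ τ lam η α 1 1 0 = 0 ∧
      deriv (fjlC σ τ lam η α 1 1) 0 ≠ 0 ∧
      (∀ β : ℂ, fjlC σ τ lam η α 1 1 β = 0 → β ≠ 0 → β.re < 0) ∧
      (∀ j : ℤ, ∀ l : ℕ, 1 ≤ l → (j^2, l) ≠ ((1 : ℤ), (1 : ℕ)) →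
        ∀ β : ℂ, fjlC σ τ lam η α j l β = 0 → β.re < 0)) ∧
    (lam > η / τ + (27/4) * π^4 →
      ∃ β : ℝ, 0 < β ∧ fjl σ τ lam η α 1 1 β = 0) := by
  have hσ0 : 0 < σ := by linarith
  have hη : η * (σ * (1 - τ)) < 27 / 4 * π ^ 4 * τ ^ 2 * (σ + 1) := by
    have h1τ : 0 < 1 - τ := by linarith
    have := mul_lt_mul_of_pos_right hηc (mul_pos hσ0 h1τ)
    refine this.trans_eq ?_
    field_simp
  have hdiv : τ * (η / τ + 27 / 4 * π ^ 4) = η + τ * (27 / 4 * π ^ 4) := by field_simp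
  have hk11 : 27 / 4 * π ^ 4 * (((1 : ℤ) : ℝ) ^ 2 * α ^ 2) = gamma2 α 1 1 ^ 3 :=
    (gamma2_cubed_eq_iff hα 1 le_rfl).mpr rfl
  have hα0 : 0 < α ^ 2 := by rw [hα]; positivity
  have hg11 := gamma2_pos α 1 (l := 1) le_rfl
  refine ⟨fun hlam j l hl β h => ?_, fun hlam => ?_, fun hlam => ?_⟩
  · have hlt : τ * lam < η + τ * (27 / 4 * π ^ 4) := by
      rw [← hdiv]
      gcongr
    refine fjlC_root_re_neg hσ0 hτ0 hη hlt.le j hl h (ne_zero_of_fjlC_eq_zero hσ0 j l ?_ h)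
    have hg := gamma2_pos α j hl
    have hkg := gamma2_cubed_ge α j hl
    have hk : 0 ≤ (j : ℝ) ^ 2 * α ^ 2 := by positivity
    rcases hk.eq_or_lt with hk | hk
    · rw [← hk, mul_zero]
      positivity
    · have e1 := mul_lt_mul_of_pos_right hlt hk
      have e2 := mul_le_mul_of_nonneg_left hkg hτ0.le
      linarith
  · have heq : τ * lam = η + τ * (27 / 4 * π ^ 4) := by rw [hlam, hdiv]
    have hc : σ * τ * gamma2 α 1 1 ^ 3 + σ * ((1 : ℤ) : ℝ) ^ 2 * α ^ 2 * (η - τ * lam) = 0 := by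
      rw [heq, ← hk11]
      ring
    refine ⟨?_, ?_, fun β h hβ => fjlC_root_re_neg hσ0 hτ0 hη heq.le 1 le_rfl h hβ,
      fun j l hl hjl β h => ?_⟩
    · simp only [fjlC, hc]
      simp
    · have hdet := hurwitz_det_pos hσ0 hτ0 hg11 (by positivity) hk11.le hη heq.le
      simp only [← mul_assoc] at hdet hc
      rw [hc] at hdet
      have hb : 0 < (σ + τ + σ * τ) * gamma2 α 1 1 ^ 2 -
          σ * ((1 : ℤ) : ℝ) ^ 2 * α ^ 2 * (gamma2 α 1 1)⁻¹ * (lam - η) := by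
        refine pos_of_mul_pos_right (a := (σ + τ + 1) * gamma2 α 1 1) ?_ (by positivity)
        simpa only [mul_assoc] using hdet
      have hderiv : deriv (fjlC σ τ lam η α 1 1) 0 = _ :=
        (hasDerivAt_cubic_zero _ _ _).deriv
      rw [hderiv]
      exact Complex.ofReal_ne_zero.mpr hb.ne'
    · refine fjlC_root_re_neg hσ0 hτ0 hη heq.le j hl h (ne_zero_of_fjlC_eq_zero hσ0 j l ?_ h)
      have hlt := (gamma2_cubed_ge α j hl).lt_of_ne (mt (gamma2_cubed_eq_iff hα j hl).mp hjl)
      have := mul_lt_mul_of_pos_left hlt hτ0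
      rw [heq]
      linarith
  · have hgt : η + τ * (27 / 4 * π ^ 4) < τ * lam := by
      rw [← hdiv]
      gcongr
    have hneg : fjl σ τ lam η α 1 1 0 < 0 := by
      have := mul_lt_mul_of_pos_left hgt (mul_pos hσ0 hα0)
      simp only [fjl, ← hk11, Int.cast_one]
      linarith
    have hcont : Continuous (fjl σ τ lam η α 1 1) := by
      unfold fjl
      fun_prop
    obtain ⟨M, hM0, hM⟩ : ∃ M : ℝ, 0 ≤ M ∧ 0 ≤ fjl σ τ lam η α 1 1 M := by
      have ha : 0 ≤ (σ + τ + 1) * gamma2 α 1 1 := by positivity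
      obtain ⟨M, hM0, hM⟩ := exists_nonneg_cubic_nonneg ha _ _
      exact ⟨M, hM0, hM.trans_eq (add_assoc _ _ _).symm⟩
    obtain ⟨β, hβ, hroot⟩ := intermediate_value_Icc hM0 hcont.continuousOn ⟨hneg.le, hM⟩
    refine ⟨β, lt_of_le_of_ne hβ.1 ?_, hroot⟩
    rintro rfl
    exact hneg.ne hroot
end

section
/- Fix σ > 1 > τ > 0, α > 0 and λ, η ∈ ℝ. There exists N ∈ ℕ such that for all integers j ∈ ℤ and l ≥ 1 with j² + l² ≥ N, the cubic polynomial f_{jl} has three pairwise distinct real roots. In particular, over all (j, l) ∈ ℤ × ℕ, only finitely many of the polynomials f_{jl} have a root with nonzero imaginary part. -/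
open Real

/-- A monic real cubic with sign pattern `-, +, -, +` along an increasing sequence of four points
has three distinct real roots, expressed by Vieta's formulas. -/
theorem exists_vieta_of_sign_changes {A B C x₀ x₁ x₂ x₃ : ℝ}
    (h₀₁ : x₀ < x₁) (h₁₂ : x₁ < x₂) (h₂₃ : x₂ < x₃)
    (hx₀ : x₀ ^ 3 + A * x₀ ^ 2 + B * x₀ + C < 0) (hx₁ : 0 < x₁ ^ 3 + A * x₁ ^ 2 + B * x₁ + C)
    (hx₂ : x₂ ^ 3 + A * x₂ ^ 2 + B * x₂ + C < 0) (hx₃ : 0 < x₃ ^ 3 + A * x₃ ^ 2 + B * x₃ + C) :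
    ∃ b₁ b₂ b₃ : ℝ, b₁ < b₂ ∧ b₂ < b₃ ∧ A = -(b₁ + b₂ + b₃) ∧
      B = b₁ * b₂ + b₁ * b₃ + b₂ * b₃ ∧ C = -(b₁ * b₂ * b₃) := by
  have hc : Continuous fun x : ℝ => x ^ 3 + A * x ^ 2 + B * x + C := by fun_prop
  obtain ⟨b₁, ⟨-, hb₁⟩, e₁⟩ := intermediate_value_Ioo h₀₁.le hc.continuousOn ⟨hx₀, hx₁⟩
  obtain ⟨b₂, ⟨hb₂, hb₂'⟩, e₂⟩ := intermediate_value_Ioo' h₁₂.le hc.continuousOn ⟨hx₂, hx₁⟩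
  obtain ⟨b₃, ⟨hb₃, -⟩, e₃⟩ := intermediate_value_Ioo h₂₃.le hc.continuousOn ⟨hx₂, hx₃⟩
  have h₁₂ : b₁ < b₂ := hb₁.trans hb₂
  have h₂₃ : b₂ < b₃ := hb₂'.trans hb₃
  dsimp only at e₁ e₂ e₃
  have d₁ : b₁ ^ 2 + b₁ * b₂ + b₂ ^ 2 + A * (b₁ + b₂) + B = 0 :=
    mul_left_cancel₀ (sub_ne_zero.2 h₁₂.ne) (by linear_combination e₁ - e₂)
  have d₂ : b₂ ^ 2 + b₂ * b₃ + b₃ ^ 2 + A * (b₂ + b₃) + B = 0 :=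
    mul_left_cancel₀ (sub_ne_zero.2 h₂₃.ne) (by linear_combination e₂ - e₃)
  have hA : A = -(b₁ + b₂ + b₃) :=
    mul_left_cancel₀ (sub_ne_zero.2 (h₁₂.trans h₂₃).ne) (by linear_combination d₁ - d₂)
  have hB : B = b₁ * b₂ + b₁ * b₃ + b₂ * b₃ := by
    linear_combination d₁ - (b₁ + b₂) * hA
  exact ⟨b₁, b₂, b₃, h₁₂, h₂₃, hA, hB, by
    linear_combination e₁ - b₁ ^ 2 * hA - b₁ * hB⟩

/-- A bounded perturbation of relative size `g⁻²` of the cubic with roots `-σ g < -g < -τ g` has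
three distinct real roots once `g` is large. -/
theorem exists_vieta_of_large (σ τ D E : ℝ) (hσ : 1 < σ) (hτ1 : τ < 1) (hτ0 : 0 < τ) :
    ∃ G : ℝ, ∀ g s : ℝ, G ≤ g → 0 ≤ s → s ≤ g →
      ∃ b₁ b₂ b₃ : ℝ, b₁ < b₂ ∧ b₂ < b₃ ∧ (σ + τ + 1) * g = -(b₁ + b₂ + b₃) ∧
        (σ + τ + σ * τ) * g ^ 2 - σ * s * g⁻¹ * D = b₁ * b₂ + b₁ * b₃ + b₂ * b₃ ∧
        σ * τ * g ^ 3 + σ * s * E = -(b₁ * b₂ * b₃) := by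
  let P : ℝ → ℝ := fun x => (x + 1) * (x + σ) * (x + τ)
  have hP₀ : P (-(σ + 1)) < 0 := by
    have : 0 < σ * (σ + 1 - τ) := by apply mul_pos <;> linarith
    simp only [P]; linarith
  have hP₁ : 0 < P (-((σ + 1) / 2)) := by
    have : 0 < (σ - 1) * (σ - 1) * (σ + 1 - 2 * τ) := by
      refine mul_pos (mul_pos ?_ ?_) ?_ <;> linarith
    simp only [P]; linarith
  have hP₂ : P (-((τ + 1) / 2)) < 0 := by
    have : 0 < (1 - τ) * (1 - τ) * (2 * σ - τ - 1) := by
      refine mul_pos (mul_pos ?_ ?_) ?_ <;> linarith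
    simp only [P]; linarith
  have hP₃ : 0 < P 0 := by
    have : 0 < σ * τ := by apply mul_pos <;> linarith
    simp only [P]; linarith
  obtain ⟨c, hc, hc₀, hc₁, hc₂, hc₃⟩ : ∃ c : ℝ, 0 < c ∧ c ≤ -P (-(σ + 1)) ∧
      c ≤ P (-((σ + 1) / 2)) ∧ c ≤ -P (-((τ + 1) / 2)) ∧ c ≤ P 0 :=
    ⟨min (min (-P (-(σ + 1))) (P (-((σ + 1) / 2)))) (min (-P (-((τ + 1) / 2))) (P 0)),
      lt_min (lt_min (neg_pos.2 hP₀) hP₁) (lt_min (neg_pos.2 hP₂) hP₃), by simp, by simp, by simp, by simp⟩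
  set K : ℝ := |E| + |D| * (σ + 1) with hK
  have hK0 : 0 ≤ K := by positivity
  refine ⟨max 1 (σ * K / c + 1), fun g s hg hs hsg => ?_⟩
  have hg1 : 1 ≤ g := (le_max_left _ _).trans hg
  have hg0 : 0 < g := by linarith
  have hgc : σ * K < c * g := by
    have : σ * K / c < g := by linarith [(le_max_right 1 (σ * K / c + 1)).trans hg]
    rw [div_lt_iff₀ hc] at this
    linarith
  have key (x : ℝ) (hx : |x| ≤ σ + 1) : |σ * s * (E - D * x)| < c * g ^ 3 := by
    have h₁ : |E - D * x| ≤ K := by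
      calc |E - D * x| ≤ |E| + |D * x| := abs_sub _ _
        _ ≤ K := by rw [abs_mul, hK]; gcongr
    calc |σ * s * (E - D * x)| = σ * s * |E - D * x| := by
          rw [abs_mul, abs_of_nonneg (by positivity)]
      _ ≤ σ * g * K := by gcongr
      _ = σ * K * g := by ring
      _ < c * g * g := by gcongr
      _ = c * g ^ 2 * 1 := by ring
      _ ≤ c * g ^ 2 * g := by gcongr
      _ = c * g ^ 3 := by ring
  have eval_eq (x : ℝ) : (g * x) ^ 3 + (σ + τ + 1) * g * (g * x) ^ 2 +
      ((σ + τ + σ * τ) * g ^ 2 - σ * s * g⁻¹ * D) * (g * x) + (σ * τ * g ^ 3 + σ * s * E) =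
      P x * g ^ 3 + σ * s * (E - D * x) := by
    simp only [P]; field_simp; ring
  have neg (x : ℝ) (hx : |x| ≤ σ + 1) (h : c ≤ -P x) :
      P x * g ^ 3 + σ * s * (E - D * x) < 0 := by
    have := mul_le_mul_of_nonneg_right h (pow_pos hg0 3).le
    linarith [(abs_lt.1 (key x hx)).2]
  have pos (x : ℝ) (hx : |x| ≤ σ + 1) (h : c ≤ P x) :
      0 < P x * g ^ 3 + σ * s * (E - D * x) := by
    have := mul_le_mul_of_nonneg_right h (pow_pos hg0 3).le
    linarith [(abs_lt.1 (key x hx)).1]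
  refine exists_vieta_of_sign_changes (x₀ := g * -(σ + 1)) (x₁ := g * -((σ + 1) / 2))
    (x₂ := g * -((τ + 1) / 2)) (x₃ := g * 0) ?_ ?_ ?_ ?_ ?_ ?_ ?_
  · gcongr; linarith
  · gcongr; linarith
  · gcongr; linarith
  · rw [eval_eq]; exact neg _ (abs_le.2 ⟨by linarith, by linarith⟩) hc₀
  · rw [eval_eq]; exact pos _ (abs_le.2 ⟨by linarith, by linarith⟩) hc₁
  · rw [eval_eq]; exact neg _ (abs_le.2 ⟨by linarith, by linarith⟩) hc₂
  · rw [eval_eq]; exact pos _ (abs_le.2 ⟨by linarith, by linarith⟩) hc₃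

theorem exists_le_gamma2 {α : ℝ} (hα : 0 < α) (G : ℝ) :
    ∃ N : ℕ, ∀ (j : ℤ) (l : ℕ), (N : ℤ) ≤ j ^ 2 + (l : ℤ) ^ 2 → G ≤ gamma2 α j l := by
  have hm : 0 < min (α ^ 2) (π ^ 2) := lt_min (by positivity) (by positivity)
  obtain ⟨N, hN⟩ := exists_nat_ge (G / min (α ^ 2) (π ^ 2))
  refine ⟨N, fun j l h => ?_⟩
  have h' : (N : ℝ) ≤ (j : ℝ) ^ 2 + (l : ℝ) ^ 2 := by exact_mod_cast h
  rw [div_le_iff₀ hm] at hN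
  calc G ≤ N * min (α ^ 2) (π ^ 2) := hN
    _ ≤ ((j : ℝ) ^ 2 + (l : ℝ) ^ 2) * min (α ^ 2) (π ^ 2) := by gcongr
    _ = (j : ℝ) ^ 2 * min (α ^ 2) (π ^ 2) + (l : ℝ) ^ 2 * min (α ^ 2) (π ^ 2) := by ring
    _ ≤ gamma2 α j l := by
      unfold gamma2
      gcongr
      · exact min_le_left _ _
      · exact min_le_right _ _

theorem finite_sq_add_sq_lt (N : ℕ) : {q : ℤ × ℕ | q.1 ^ 2 + (q.2 : ℤ) ^ 2 < N}.Finite := by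
  refine ((Set.finite_Icc (-(N : ℤ)) N).prod (Set.finite_Iic N)).subset ?_
  rintro ⟨j, l⟩ h
  simp only [Set.mem_ofPred_eq] at h
  simp only [Set.mem_prod, Set.mem_Icc, Set.mem_Iic]
  refine ⟨⟨?_, ?_⟩, ?_⟩
  · nlinarith
  · nlinarith
  · zify
    nlinarith

/-- for σ > 1 > τ > 0, all but finitely many of the cubics f_{jl}
have three pairwise distinct real roots; in particular only finitely many of them
have a root with nonzero imaginary part. -/
theorem stmt6 (σ τ lam η α : ℝ)
    (hσ : 1 < σ) (hτ1 : τ < 1) (hτ0 : 0 < τ) (hα : 0 < α) :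
    (∃ N : ℕ, ∀ j : ℤ, ∀ l : ℕ, 1 ≤ l → (N : ℤ) ≤ j^2 + (l : ℤ)^2 →
      ∃ b₁ b₂ b₃ : ℝ, b₁ ≠ b₂ ∧ b₁ ≠ b₃ ∧ b₂ ≠ b₃ ∧
        ∀ β : ℝ, fjl σ τ lam η α j l β = (β - b₁) * (β - b₂) * (β - b₃)) ∧
    Set.Finite {q : ℤ × ℕ | 1 ≤ q.2 ∧
      ∃ β : ℂ, fjlC σ τ lam η α q.1 q.2 β = 0 ∧ β.im ≠ 0} := by
  obtain ⟨G, hG⟩ := exists_vieta_of_large σ τ (lam - η) (η - τ * lam) hσ hτ1 hτ0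
  obtain ⟨N, hN⟩ := exists_le_gamma2 hα G
  have vieta (j : ℤ) (l : ℕ) (h : (N : ℤ) ≤ j ^ 2 + (l : ℤ) ^ 2) :=
    hG (gamma2 α j l) ((j : ℝ) ^ 2 * α ^ 2) (hN j l h) (by positivity)
      (le_add_of_nonneg_right (by positivity))
  refine ⟨⟨N, fun j l _ h => ?_⟩, (finite_sq_add_sq_lt N).subset ?_⟩
  · obtain ⟨b₁, b₂, b₃, h₁₂, h₂₃, hA, hB, hC⟩ := vieta j l h
    refine ⟨b₁, b₂, b₃, h₁₂.ne, (h₁₂.trans h₂₃).ne, h₂₃.ne, fun β => ?_⟩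
    unfold fjl
    linear_combination β ^ 2 * hA + β * hB + hC
  · rintro ⟨j, l⟩ ⟨-, β, hβ, him⟩
    by_contra h
    obtain ⟨b₁, b₂, b₃, -, -, hA, hB, hC⟩ := vieta j l (not_lt.1 h)
    have hroot : (β - b₁) * (β - b₂) * (β - b₃) = 0 := by
      simp only [← mul_assoc] at hB hC
      rw [← hβ, fjlC, hA, hB, hC]
      push_cast
      ring
    have real_of_sub {b : ℝ} (hb : β - b = 0) : β.im = 0 := by
      rw [sub_eq_zero.1 hb, Complex.ofReal_im]
    rcases mul_eq_zero.1 hroot with h' | h₃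
    · rcases mul_eq_zero.1 h' with h₁ | h₂
      · exact him (real_of_sub h₁)
      · exact him (real_of_sub h₂)
    · exact him (real_of_sub h₃)
end

section
/- Fix σ > 1 > τ > 0, α > 0 and λ, η ∈ ℝ. For every M > 0 there exists N ∈ ℕ such that for all integers j ∈ ℤ and l ≥ 1 with j² + l² ≥ N, every complex root β of the cubic polynomial f_{jl} satisfies Re β ≤ −M. In other words, the real parts of the roots of f_{jl} tend uniformly to −∞ as j² + l² → ∞. -/
open Real

lemma min_sq_mul_le_gamma2 (α : ℝ) (j : ℤ) (l : ℕ) :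
    min (α ^ 2) 1 * ((j : ℝ) ^ 2 + (l : ℝ) ^ 2) ≤ gamma2 α j l := by
  have hpi : (1 : ℝ) ≤ π ^ 2 := by nlinarith [pi_gt_three]
  have hj := mul_le_mul_of_nonneg_left (min_le_left (α ^ 2) 1) (sq_nonneg (j : ℝ))
  have hl := mul_le_mul_of_nonneg_left ((min_le_right (α ^ 2) 1).trans hpi) (sq_nonneg (l : ℝ))
  unfold gamma2
  linarith

lemma sq_mul_sq_le_gamma2 (α : ℝ) (j : ℤ) (l : ℕ) : (j : ℝ) ^ 2 * α ^ 2 ≤ gamma2 α j l := by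
  unfold gamma2
  linarith [mul_nonneg (sq_nonneg (l : ℝ)) (sq_nonneg π)]

/-- A linear perturbation, with coefficients of size `C` and `C * g`, of a cubic with roots
`-g`, `-σ * g`, `-τ * g` has no roots of real part larger than `-M` once `g` is large. -/
lemma re_le_of_perturbed_cubic_eq_zero {σ τ g p q C M : ℝ} (hσ : 1 ≤ σ) (hτ1 : τ ≤ 1)
    (hτ0 : 0 < τ) (hg : 0 < g) (hp : |p| ≤ C) (hq : |q| ≤ C * g)
    (hMg : 2 * M ≤ τ * g) (hCg : 20 * C < (τ * g) ^ 2) {β : ℂ}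
    (h : (β + g) * (β + (σ * g : ℝ)) * (β + (τ * g : ℝ)) + p * β + q = 0) :
    β.re ≤ -M := by
  by_contra! hre
  have hτg : τ * g ≤ g := by nlinarith
  have hσg : g ≤ σ * g := by nlinarith
  have h_norm (x : ℝ) : β.re + x ≤ ‖β + x‖ := by
    simpa using Complex.re_le_norm (β + x)
  have hpos : 0 < τ * g := mul_pos hτ0 hg
  have h1 : g / 2 ≤ ‖β + g‖ := by linarith [h_norm g]
  have h2 : τ * g / 2 ≤ ‖β + (σ * g : ℝ)‖ := by linarith [h_norm (σ * g)]
  have h3 : τ * g / 2 ≤ ‖β + (τ * g : ℝ)‖ := by linarith [h_norm (τ * g)]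
  have hβ : ‖β‖ ≤ ‖β + g‖ + g := by
    simpa [abs_of_pos hg] using norm_sub_le (β + g) (g : ℂ)
  have hC : 0 ≤ C := (abs_nonneg p).trans hp
  have h_upper : ‖β + g‖ * ‖β + (σ * g : ℝ)‖ * ‖β + (τ * g : ℝ)‖ ≤ C * (5 * ‖β + g‖) := by
    have heq : (β + g) * (β + (σ * g : ℝ)) * (β + (τ * g : ℝ)) = -(p * β + q) := by
      linear_combination h
    rw [← norm_mul, ← norm_mul, heq, norm_neg]
    calc ‖(p : ℂ) * β + q‖ ≤ |p| * ‖β‖ + |q| := by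
          simpa using norm_add_le ((p : ℂ) * β) (q : ℂ)
      _ ≤ C * ‖β‖ + C * g := by gcongr
      _ = C * (‖β‖ + g) := by ring
      _ ≤ C * (5 * ‖β + g‖) := by gcongr; linarith
  have h_lower : ‖β + g‖ * (τ * g / 2) * (τ * g / 2) ≤
      ‖β + g‖ * ‖β + (σ * g : ℝ)‖ * ‖β + (τ * g : ℝ)‖ := by gcongr
  nlinarith

/-- for σ > 1 > τ > 0, the real parts of the roots of f_{jl}
tend uniformly to −∞ as j² + l² → ∞. -/
theorem stmt7 (σ τ lam η α : ℝ)
    (hσ : 1 < σ) (hτ1 : τ < 1) (hτ0 : 0 < τ) (hα : 0 < α) :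
    ∀ M : ℝ, 0 < M → ∃ N : ℕ, ∀ j : ℤ, ∀ l : ℕ, 1 ≤ l →
      (N : ℤ) ≤ j^2 + (l : ℤ)^2 →
      ∀ β : ℂ, fjlC σ τ lam η α j l β = 0 → β.re ≤ -M := by
  intro M hM
  set C := σ * (|lam - η| + |η - τ * lam|) with hC_def
  have hC : 0 ≤ C := by positivity
  set G := 2 * M / τ + 20 * C / τ ^ 2 + 1
  have hm : 0 < min (α ^ 2) 1 := lt_min (by positivity) one_pos
  obtain ⟨N, hN⟩ := exists_nat_ge (G / min (α ^ 2) 1)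
  refine ⟨N, fun j l _ hjl β hβ => ?_⟩
  have hjl' : (N : ℝ) ≤ (j : ℝ) ^ 2 + (l : ℝ) ^ 2 := by exact_mod_cast hjl
  have hG : G ≤ gamma2 α j l := by
    rw [div_le_iff₀' hm] at hN
    exact (hN.trans (by gcongr)).trans (min_sq_mul_le_gamma2 α j l)
  have hjg := sq_mul_sq_le_gamma2 α j l
  unfold fjlC at hβ
  set g := gamma2 α j l
  have hM' : 0 ≤ 2 * M / τ := by positivity
  have hC' : 0 ≤ 20 * C / τ ^ 2 := by positivity
  have hg1 : 1 ≤ g := by linarith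
  have hg : 0 < g := by linarith
  have hj0 : 0 ≤ (j : ℝ) ^ 2 * α ^ 2 := by positivity
  refine re_le_of_perturbed_cubic_eq_zero (σ := σ) (τ := τ) (g := g) (C := C)
    (p := -(σ * (j : ℝ) ^ 2 * α ^ 2 * g⁻¹ * (lam - η)))
    (q := σ * (j : ℝ) ^ 2 * α ^ 2 * (η - τ * lam))
    hσ.le hτ1.le hτ0 hg ?_ ?_ ?_ ?_ ?_
  · have hle : (j : ℝ) ^ 2 * α ^ 2 * g⁻¹ ≤ 1 := by
      rw [← div_eq_mul_inv]
      exact div_le_one_of_le₀ hjg hg.le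
    calc |-(σ * (j : ℝ) ^ 2 * α ^ 2 * g⁻¹ * (lam - η))|
        = σ * ((j : ℝ) ^ 2 * α ^ 2 * g⁻¹ * |lam - η|) := by
          rw [abs_neg, abs_mul, abs_of_nonneg (by positivity)]
          ring
      _ ≤ σ * (1 * |lam - η|) := by gcongr
      _ ≤ C := by
          rw [hC_def, one_mul]
          gcongr
          exact le_add_of_nonneg_right (abs_nonneg _)
  · calc |σ * (j : ℝ) ^ 2 * α ^ 2 * (η - τ * lam)|
        = σ * |η - τ * lam| * ((j : ℝ) ^ 2 * α ^ 2) := by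
          rw [abs_mul, abs_of_nonneg (by positivity)]
          ring
      _ ≤ C * g := by
          rw [hC_def]
          gcongr
          exact le_add_of_nonneg_left (abs_nonneg _)
  · rw [← div_le_iff₀' hτ0]
    linarith
  · rw [mul_pow, ← div_lt_iff₀' (by positivity)]
    nlinarith
  · push_cast at hβ ⊢
    linear_combination hβ
end

section
/- Let σ > 1 > τ > 0 and 0 < η < η_c. Set γ⁴ := 9π⁴/4, λ_c := η/τ + (27/4)π⁴, a := σλ_c/γ⁴, b := −ση/(τ²γ⁴), and δ := (a + τ⁻¹b)/(3 + a + b). Then 3 + a + b > 0, and: δ > 0 if η < η_{c1}; δ = 0 if η = η_{c1}; δ < 0 if η_{c1} < η < η_c. -/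
open Real

/-- sign of the cubic coefficient δ of the reduced bifurcation
equations, for σ > 1 > τ > 0 and 0 < η < η_c. -/
theorem stmt11 (σ τ η : ℝ)
    (hσ : 1 < σ) (hτ1 : τ < 1) (hτ0 : 0 < τ)
    (hη0 : 0 < η)
    (hηc : η < (27/4) * π^4 * τ^2 * (1 + σ⁻¹) * (1 - τ)⁻¹) :
    let γ4 : ℝ := 9 * π^4 / 4
    let lamc : ℝ := η / τ + (27/4) * π^4
    let a : ℝ := σ * lamc / γ4
    let b : ℝ := -(σ * η) / (τ^2 * γ4)
    let δ : ℝ := (a + τ⁻¹ * b) / (3 + a + b)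
    0 < 3 + a + b ∧
    (η < (27/4) * π^4 * τ^3 * (1 - τ^2)⁻¹ → 0 < δ) ∧
    (η = (27/4) * π^4 * τ^3 * (1 - τ^2)⁻¹ → δ = 0) ∧
    ((27/4) * π^4 * τ^3 * (1 - τ^2)⁻¹ < η → δ < 0) := by
  intro γ4 lamc a b δ
  have hπ : 0 < π := Real.pi_pos
  have hγ4 : 0 < γ4 := by positivity
  have hσ0 : 0 < σ := one_pos.trans hσ
  have h1τ : 0 < 1 - τ := sub_pos.2 hτ1
  have h1τ2 : 0 < 1 - τ ^ 2 := by nlinarith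
  have hden : 3 + a + b = σ * (1 - τ) / (τ ^ 2 * γ4) *
      ((27/4) * π^4 * τ^2 * (1 + σ⁻¹) * (1 - τ)⁻¹ - η) := by
    simp only [a, b, lamc, γ4]
    field_simp
    ring
  have hnum : a + τ⁻¹ * b = σ * (1 - τ ^ 2) / (τ ^ 3 * γ4) *
      ((27/4) * π^4 * τ^3 * (1 - τ^2)⁻¹ - η) := by
    simp only [a, b, lamc, γ4]
    field_simp
    ring
  have hpos : 0 < 3 + a + b := by
    rw [hden]
    exact mul_pos (by positivity) (sub_pos.2 hηc)
  have hcoef : 0 < σ * (1 - τ ^ 2) / (τ ^ 3 * γ4) := by positivity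
  refine ⟨hpos, fun h => div_pos ?_ hpos, fun h => ?_, fun h => div_neg_of_neg_of_pos ?_ hpos⟩
  · rw [hnum]
    exact mul_pos hcoef (sub_pos.2 h)
  · have hzero : a + τ⁻¹ * b = 0 := by rw [hnum, ← h, sub_self, mul_zero]
    simp only [δ, hzero, zero_div]
  · rw [hnum]
    exact mul_neg_of_pos_of_neg hcoef (sub_neg.2 h)
end

section
/- Let σ > 0, τ > 0, α > 0, j ∈ ℤ with j ≠ 0, l ≥ 1, and λ, η ∈ ℝ with λ > η. Then the cubic polynomial f_{jl} has no complex root of multiplicity three. (Equivalently, the discriminant of the derivative f_{jl}' is positive: it equals 4·{(1/2)[(σ−τ)² + (σ−1)² + (τ−1)²]γ_{jl}⁴ + 3σ j²α² γ_{jl}^{-2}(λ−η)} > 0.) -/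
open Real

/-- If a monic cubic is a perfect cube, its quadratic and linear coefficients satisfy `a² = 3b`. -/
theorem sq_eq_three_mul_of_cubic_eq_cube {a b c β : ℂ}
    (h : ∀ z : ℂ, z^3 + a * z^2 + b * z + c = (z - β)^3) : a^2 = 3 * b := by
  have h0 := h 0
  have h1 := h 1
  have h2 := h (-1)
  have ha : a = -3 * β := by linear_combination (h1 + h2) / 2 - h0
  have hb : b = 3 * β^2 := by linear_combination (h1 - h2) / 2
  rw [ha, hb]
  ring

/-- for j ≠ 0 and λ > η, f_{jl} has no complex root of
multiplicity three; equivalently the discriminant of f_{jl}' is the stated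
positive quantity. -/
theorem stmt15 (σ τ lam η α : ℝ) (j : ℤ) (l : ℕ)
    (hσ : 0 < σ) (hτ : 0 < τ) (hα : 0 < α) (hj : j ≠ 0) (hl : 1 ≤ l)
    (hlη : η < lam) :
    (∀ β : ℂ, ¬ (∀ z : ℂ, fjlC σ τ lam η α j l z = (z - β)^3)) ∧
    (2 * ((σ + τ + 1) * gamma2 α j l))^2
        - 4 * 3 * ((σ + τ + σ*τ) * (gamma2 α j l)^2
            - σ * (j : ℝ)^2 * α^2 * (gamma2 α j l)⁻¹ * (lam - η))
      = 4 * ((1/2) * ((σ - τ)^2 + (σ - 1)^2 + (τ - 1)^2) * (gamma2 α j l)^2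
          + 3 * σ * (j : ℝ)^2 * α^2 * (gamma2 α j l)⁻¹ * (lam - η)) ∧
    0 < 4 * ((1/2) * ((σ - τ)^2 + (σ - 1)^2 + (τ - 1)^2) * (gamma2 α j l)^2
          + 3 * σ * (j : ℝ)^2 * α^2 * (gamma2 α j l)⁻¹ * (lam - η)) := by
  have hj2 : 0 < (j : ℝ)^2 := by positivity
  have hγ : 0 < gamma2 α j l := by unfold gamma2; positivity
  have hd : 0 < lam - η := sub_pos.2 hlη
  have hpos : 0 < 4 * ((1/2) * ((σ - τ)^2 + (σ - 1)^2 + (τ - 1)^2) * (gamma2 α j l)^2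
      + 3 * σ * (j : ℝ)^2 * α^2 * (gamma2 α j l)⁻¹ * (lam - η)) := by positivity
  refine ⟨fun β h => ?_, by ring, hpos⟩
  have hsq := sq_eq_three_mul_of_cubic_eq_cube h
  rw [← Complex.ofReal_pow, ← Complex.ofReal_ofNat 3, ← Complex.ofReal_mul,
    Complex.ofReal_inj] at hsq
  linarith
end
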